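/- arXiv:1902.00582 — 4 statements merged into one kernel-verified Lean document; each statement's English description precedes it below -/
import Mathlib

section
/- Let V → X_{≤n} → Z be a Markov chain in which, conditional on V, the observations X_1,…,X_n are i.i.d. taking values in a finite set 𝒳, and the transcript Z satisfies Assumption A1′: Z is (ε, δ)-differentially private as a function of the sample (for samples in 𝒳^n differing in one entry), where (ε, δ) satisfy δ ≤ min{ε,1}/256, δ·max{ε^{−1},1}·log(1/(δ·max{ε^{−1},1})) ≤ ε², δ ≤ min{ε, ε²}/log²|𝒳|, and, if ε ≤ 1/6, additionally δ ≤ ε⁵/(64 log²|𝒳|) and δ·log²(ε/δ) ≤ ε⁵/16. Then I(X_{≤n}; Z | V) ≤ n · min{9ε, 75ε²}. -/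
open Finset

/-- `p` is a probability mass function on the finite type `Ω`. -/
def IsPMF {Ω : Type*} [Fintype Ω] (p : Ω → ℝ) : Prop :=
  (∀ ω, 0 ≤ p ω) ∧ ∑ ω, p ω = 1

/-- Shannon entropy (natural logarithm) of the pushforward of the pmf `p` along `f`. -/
noncomputable def ent {Ω A : Type*} [Fintype Ω] [Fintype A] [DecidableEq A]
    (p : Ω → ℝ) (f : Ω → A) : ℝ :=
  ∑ a, Real.negMulLog (∑ ω ∈ Finset.univ.filter (fun ω => f ω = a), p ω)

/-- Mutual information `I(f; g)` under the joint pmf `p`. -/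
noncomputable def mi {Ω A B : Type*} [Fintype Ω] [Fintype A] [DecidableEq A]
    [Fintype B] [DecidableEq B] (p : Ω → ℝ) (f : Ω → A) (g : Ω → B) : ℝ :=
  ent p f + ent p g - ent p fun ω => (f ω, g ω)

/-- Conditional mutual information `I(f; g | c)` under the joint pmf `p`. -/
noncomputable def condMI {Ω A B C : Type*} [Fintype Ω] [Fintype A] [DecidableEq A]
    [Fintype B] [DecidableEq B] [Fintype C] [DecidableEq C]
    (p : Ω → ℝ) (f : Ω → A) (g : Ω → B) (c : Ω → C) : ℝ :=
  ent p (fun ω => (f ω, c ω)) + ent p (fun ω => (g ω, c ω))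
    - ent p (fun ω => (f ω, g ω, c ω)) - ent p c

/-- The mutual information `∑ z, (h (∑ x, μ x * Q x z) - ∑ x, μ x * h (Q x z))`, `h t = -t log t`,
between an input with law `μ` and the output of the channel `Q`. -/
noncomputable def channelInfo {A B : Type*} [Fintype A] [Fintype B]
    (μ : A → ℝ) (Q : A → B → ℝ) : ℝ :=
  ∑ z, (Real.negMulLog (∑ x, μ x * Q x z) - ∑ x, μ x * Real.negMulLog (Q x z))

/-- Any two rows of the channel `Q` are `(ε, δ)`-indistinguishable. -/
def IsDPChannel {A B : Type*} (ε δ : ℝ) (Q : A → B → ℝ) : Prop :=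
  ∀ (S : Finset B) (x x' : A), ∑ z ∈ S, Q x z ≤ Real.exp ε * ∑ z ∈ S, Q x' z + δ

theorem mul_log_div_le {a b ε t : ℝ} (ha : 0 ≤ a) (hb : 0 < b) (hε : 0 < ε) (ht : 0 ≤ t)
    (hab : a ≤ Real.exp t * b) :
    a * Real.log (a / b) ≤ (a - b) + ε * |a - b| + t * max (a - Real.exp ε * b) 0
      + max (b - Real.exp ε * a) 0 := by
  rcases ha.eq_or_lt with rfl | ha
  · have h1 : |0 - b| = b := by rw [zero_sub, abs_neg, abs_of_pos hb]
    rw [h1]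
    have h2 := le_max_left (b - Real.exp ε * 0) 0
    have h3 := mul_nonneg ht (le_max_right (0 - Real.exp ε * b) 0)
    have h4 := mul_pos hε hb
    simp only [zero_mul, mul_zero, sub_zero] at *
    linarith
  set s := Real.log (a / b) with hs
  have hes : Real.exp s * b = a := by
    rw [hs, Real.exp_log (by positivity)]; field_simp
  have hes' : Real.exp (-s) * a = b := by
    rw [← hes, ← mul_assoc, ← Real.exp_add]; simp
  have hexpε := Real.add_one_le_exp ε
  rcases le_total 0 s with h0 | h0
  · have h1 : b ≤ a := by
      rw [← hes]; nlinarith [Real.one_le_exp h0]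
    rw [abs_of_nonneg (by linarith)]
    have h3 := le_max_right (b - Real.exp ε * a) 0
    rcases le_total s ε with h2 | h2
    · have h4 := mul_nonneg ht (le_max_right (a - Real.exp ε * b) 0)
      have h5 : b * (s + 1) ≤ a := by
        rw [← hes]; nlinarith [Real.add_one_le_exp s]
      nlinarith [mul_nonneg (sub_nonneg.2 h2) (sub_nonneg.2 h1)]
    · have hst : s ≤ t := by
        rw [← hes] at hab
        exact Real.exp_le_exp.1 (le_of_mul_le_mul_right hab hb)
      have h6 : Real.exp ε * b ≤ a := by
        rw [← hes]; gcongr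
      have h4 := le_max_left (a - Real.exp ε * b) 0
      have h7 : (s - ε) * (a - Real.exp ε * b) ≤ t * max (a - Real.exp ε * b) 0 := by
        apply mul_le_mul (by linarith) h4 (by linarith) ht
      have h8 : b * (1 + ε + Real.exp ε * (s - ε)) ≤ a := by
        rw [← hes, mul_comm]
        gcongr
        have : Real.exp s = Real.exp ε * Real.exp (s - ε) := by rw [← Real.exp_add]; ring_nf
        rw [this]
        nlinarith [Real.add_one_le_exp (s - ε), Real.exp_pos ε]
      nlinarith
  · have h1 : a ≤ b := by
      rw [← hes]; nlinarith [Real.exp_le_one_iff.2 h0]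
    rw [abs_of_nonpos (by linarith)]
    have h3 := mul_nonneg ht (le_max_right (a - Real.exp ε * b) 0)
    rcases le_total (-s) ε with h2 | h2
    · have h4 := le_max_right (b - Real.exp ε * a) 0
      have h5 : b * (1 + s) ≤ a := by
        rw [← hes]; nlinarith [Real.add_one_le_exp s]
      nlinarith [mul_nonneg (sub_nonneg.2 h2) (sub_nonneg.2 h1)]
    · have h4 := le_max_left (b - Real.exp ε * a) 0
      have h6 : Real.exp ε * a ≤ b := by
        rw [← hes']; gcongr
      have h7 : a * (Real.exp ε - 1 - ε) ≤ ε * (Real.exp ε * a - a) := by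
        have : Real.exp ε * (1 - ε) ≤ 1 := by
          have := Real.add_one_le_exp (-ε)
          calc Real.exp ε * (1 - ε) ≤ Real.exp ε * Real.exp (-ε) := by gcongr; linarith
            _ = 1 := by rw [← Real.exp_add]; simp
        nlinarith
      nlinarith

theorem sum_max_sub_le {B : Type*} [Fintype B] {p q : B → ℝ} {c δ : ℝ}
    (h : ∀ S : Finset B, ∑ z ∈ S, p z ≤ c * ∑ z ∈ S, q z + δ) :
    ∑ z, max (p z - c * q z) 0 ≤ δ := by
  classical
  have h1 := h (univ.filter fun z => 0 < p z - c * q z)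
  have h2 : ∑ z, max (p z - c * q z) 0
      = ∑ z ∈ univ.filter (fun z => 0 < p z - c * q z), (p z - c * q z) := by
    rw [sum_filter]
    refine sum_congr rfl fun z _ => ?_
    split_ifs with hz
    · exact max_eq_left hz.le
    · exact max_eq_right (not_lt.1 hz)
  rw [h2, sum_sub_distrib, ← mul_sum]
  linarith

theorem sum_mul_neg_log_le {A : Type*} [Fintype A] {μ : A → ℝ} (hμ : IsPMF μ) :
    ∑ x, μ x * -Real.log (μ x) ≤ Real.log (Fintype.card A) := by
  have hne : Nonempty A := by
    by_contra h
    have := not_nonempty_iff.1 h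
    have := hμ.2
    simp at this
  have hN : (0 : ℝ) < Fintype.card A := by exact_mod_cast Fintype.card_pos
  have key : ∀ x, μ x * -Real.log (μ x)
      ≤ μ x * Real.log (Fintype.card A) + (1 / Fintype.card A - μ x) := by
    intro x
    rcases (hμ.1 x).eq_or_lt with h | h
    · rw [← h]; simp
    · have h1 := Real.log_le_sub_one_of_pos (x := 1 / (Fintype.card A * μ x)) (by positivity)
      rw [one_div, Real.log_inv, Real.log_mul hN.ne' h.ne'] at h1
      have h2 := mul_le_mul_of_nonneg_left h1 h.le
      have h3 : μ x * ((Fintype.card A * μ x)⁻¹ - 1) = 1 / Fintype.card A - μ x := by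
        field_simp
      rw [h3] at h2
      linarith
  calc _ ≤ ∑ x, (μ x * Real.log (Fintype.card A) + (1 / Fintype.card A - μ x)) :=
        sum_le_sum fun x _ => key x
    _ = _ := by
      rw [sum_add_distrib, ← sum_mul, sum_sub_distrib, hμ.2]
      simp [hN.ne']

/-- Divergence of two `(ε, δ)`-indistinguishable laws with density at most `exp t`. -/
theorem sum_mul_log_div_le {B : Type*} [Fintype B] {p q : B → ℝ} {ε δ t : ℝ}
    (hp : IsPMF p) (hq : IsPMF q) (hε : 0 < ε) (ht : 0 ≤ t)
    (hpq : ∀ z, p z ≤ Real.exp t * q z)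
    (h1 : ∀ S : Finset B, ∑ z ∈ S, p z ≤ Real.exp ε * ∑ z ∈ S, q z + δ)
    (h2 : ∀ S : Finset B, ∑ z ∈ S, q z ≤ Real.exp ε * ∑ z ∈ S, p z + δ) :
    ∑ z, p z * Real.log (p z / q z) ≤ ε * ∑ z, |p z - q z| + t * δ + δ := by
  have key : ∀ z, p z * Real.log (p z / q z) ≤ (p z - q z) + ε * |p z - q z|
      + t * max (p z - Real.exp ε * q z) 0 + max (q z - Real.exp ε * p z) 0 := by
    intro z
    rcases (hq.1 z).eq_or_lt with h | h
    · have := hpq z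
      rw [← h, mul_zero] at this
      simp [← h, le_antisymm this (hp.1 z)]
    · exact mul_log_div_le (hp.1 z) h hε ht (hpq z)
  have h3 := sum_le_sum fun z (_ : z ∈ (univ : Finset B)) => key z
  simp only [sum_add_distrib, sum_sub_distrib, ← mul_sum, hp.2, hq.2] at h3
  have h4 := mul_le_mul_of_nonneg_left (sum_max_sub_le h1) ht
  have h5 := sum_max_sub_le h2
  linarith

theorem sum_abs_sub_le_two {B : Type*} [Fintype B] {p q : B → ℝ} (hp : IsPMF p) (hq : IsPMF q) :
    ∑ z, |p z - q z| ≤ 2 := by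
  calc ∑ z, |p z - q z| ≤ ∑ z, (p z + q z) := by
        refine sum_le_sum fun z _ => abs_le.2 ⟨?_, ?_⟩ <;> linarith [hp.1 z, hq.1 z]
    _ = 2 := by rw [sum_add_distrib, hp.2, hq.2]; norm_num

theorem sum_abs_sub_le_of_dp {B : Type*} [Fintype B] {p q : B → ℝ} {ε δ : ℝ}
    (hp : IsPMF p) (hq : IsPMF q) (hε : 0 < ε)
    (h : ∀ S : Finset B, ∑ z ∈ S, p z ≤ Real.exp ε * ∑ z ∈ S, q z + δ) :
    ∑ z, |p z - q z| ≤ 2 * (δ + (Real.exp ε - 1)) := by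
  have hexp := Real.one_le_exp hε.le
  calc ∑ z, |p z - q z|
      ≤ ∑ z, (2 * (max (p z - Real.exp ε * q z) 0 + (Real.exp ε - 1) * q z) - (p z - q z)) := by
        refine sum_le_sum fun z _ => abs_le.2 ⟨?_, ?_⟩ <;>
          nlinarith [le_max_left (p z - Real.exp ε * q z) 0,
            le_max_right (p z - Real.exp ε * q z) 0,
            mul_nonneg (sub_nonneg.2 hexp) (hq.1 z)]
    _ ≤ _ := by
        have := sum_max_sub_le h
        rw [sum_sub_distrib, ← mul_sum, sum_add_distrib, ← mul_sum, sum_sub_distrib, hp.2, hq.2]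
        linarith

theorem isPMF_mix {A B : Type*} [Fintype A] [Fintype B] {μ : A → ℝ} {Q : A → B → ℝ}
    (hμ : IsPMF μ) (hQ : ∀ x, IsPMF (Q x)) : IsPMF fun z => ∑ x, μ x * Q x z := by
  refine ⟨fun z => sum_nonneg fun x _ => mul_nonneg (hμ.1 x) ((hQ x).1 z), ?_⟩
  rw [sum_comm]
  simp [← mul_sum, (hQ _).2, hμ.2]

theorem isPMF_pi {X : Type*} [Fintype X] {μ : X → ℝ} (hμ : IsPMF μ) (n : ℕ) :
    IsPMF fun x : Fin n → X => ∏ i, μ (x i) := by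
  classical
  refine ⟨fun x => prod_nonneg fun i _ => hμ.1 _, ?_⟩
  rw [← Fintype.piFinset_univ, ← prod_univ_sum]
  simp [hμ.2]

theorem channelInfo_eq_sum_log_div {A B : Type*} [Fintype A] [Fintype B] {μ : A → ℝ}
    {Q : A → B → ℝ} (hμ : IsPMF μ) (hQ : ∀ x, IsPMF (Q x)) :
    channelInfo μ Q
      = ∑ x, μ x * ∑ z, Q x z * Real.log (Q x z / ∑ x', μ x' * Q x' z) := by
  unfold channelInfo
  simp only [mul_sum]
  rw [sum_comm (s := univ) (t := univ) (f := fun x z => μ x * _)]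
  refine sum_congr rfl fun z _ => ?_
  simp only [Real.negMulLog]
  rw [neg_mul, sum_mul, ← sum_neg_distrib, ← sum_sub_distrib]
  refine sum_congr rfl fun x _ => ?_
  rcases (hμ.1 x).eq_or_lt with h | h
  · simp [← h]
  rcases ((hQ x).1 z).eq_or_lt with h' | h'
  · simp [← h']
  have h1 : 0 < ∑ x', μ x' * Q x' z :=
    sum_pos' (fun x' _ => mul_nonneg (hμ.1 x') ((hQ x').1 z)) ⟨x, mem_univ x, mul_pos h h'⟩
  rw [Real.log_div h'.ne' h1.ne']
  ring

theorem channelInfo_le {A B : Type*} [Fintype A] [Fintype B] {μ : A → ℝ}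
    {Q : A → B → ℝ} {ε δ τ : ℝ} (hμ : IsPMF μ) (hQ : ∀ x, IsPMF (Q x)) (hε : 0 < ε)
    (hδ : 0 ≤ δ) (hDP : IsDPChannel ε δ Q)
    (hτ : ∀ p q : B → ℝ, IsPMF p → IsPMF q →
      (∀ S : Finset B, ∑ z ∈ S, p z ≤ Real.exp ε * ∑ z ∈ S, q z + δ) →
      ∑ z, |p z - q z| ≤ τ) :
    channelInfo μ Q ≤ ε * τ + Real.log (Fintype.card A) * δ + δ := by
  rw [channelInfo_eq_sum_log_div hμ hQ]
  set M : B → ℝ := fun z => ∑ x, μ x * Q x z with hM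
  have hMp : IsPMF M := isPMF_mix hμ hQ
  have hMS : ∀ S : Finset B, ∑ z ∈ S, M z = ∑ x, μ x * ∑ z ∈ S, Q x z := by
    intro S; simp only [hM, mul_sum]; exact sum_comm
  have key : ∀ x, μ x * ∑ z, Q x z * Real.log (Q x z / M z)
      ≤ μ x * (ε * τ + δ) + δ * (μ x * -Real.log (μ x)) := by
    intro x
    rcases (hμ.1 x).eq_or_lt with h | h
    · simp [← h]
    have hle : μ x ≤ 1 := hμ.2 ▸ single_le_sum (fun y _ => hμ.1 y) (mem_univ x)
    have h1 : ∀ S : Finset B, ∑ z ∈ S, Q x z ≤ Real.exp ε * ∑ z ∈ S, M z + δ := by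
      intro S
      calc ∑ z ∈ S, Q x z = ∑ y, μ y * ∑ z ∈ S, Q x z := by rw [← sum_mul, hμ.2, one_mul]
        _ ≤ ∑ y, μ y * (Real.exp ε * ∑ z ∈ S, Q y z + δ) :=
          sum_le_sum fun y _ => mul_le_mul_of_nonneg_left (hDP S x y) (hμ.1 y)
        _ = _ := by
          simp only [hMS, mul_add, sum_add_distrib, ← sum_mul, hμ.2, mul_sum, one_mul]
          simp only [mul_left_comm]
    have h2 : ∀ S : Finset B, ∑ z ∈ S, M z ≤ Real.exp ε * ∑ z ∈ S, Q x z + δ := by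
      intro S
      rw [hMS]
      calc _ ≤ ∑ y, μ y * (Real.exp ε * ∑ z ∈ S, Q x z + δ) :=
            sum_le_sum fun y _ => mul_le_mul_of_nonneg_left (hDP S y x) (hμ.1 y)
        _ = _ := by rw [← sum_mul, hμ.2, one_mul]
    have h3 := sum_mul_log_div_le (t := -Real.log (μ x)) (hQ x) hMp hε
      (neg_nonneg.2 (Real.log_nonpos h.le hle)) (fun z => by
        rw [Real.exp_neg, Real.exp_log h, inv_mul_eq_div, le_div_iff₀ h, mul_comm]
        exact single_le_sum (f := fun x => μ x * Q x z)
          (fun y _ => mul_nonneg (hμ.1 y) ((hQ y).1 z)) (mem_univ x)) h1 h2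
    have h4 := mul_le_mul_of_nonneg_left (hτ _ _ (hQ x) hMp h1) hε.le
    have h5 : ∑ z, Q x z * Real.log (Q x z / M z) ≤ ε * τ + -Real.log (μ x) * δ + δ := by
      linarith
    refine (mul_le_mul_of_nonneg_left h5 h.le).trans (le_of_eq ?_)
    ring
  calc _ ≤ ∑ x, (μ x * (ε * τ + δ) + δ * (μ x * -Real.log (μ x))) :=
        sum_le_sum fun x _ => key x
    _ = (ε * τ + δ) + δ * ∑ x, μ x * -Real.log (μ x) := by
        rw [sum_add_distrib, ← sum_mul, hμ.2, ← mul_sum, one_mul]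
    _ ≤ _ := by
        have := mul_le_mul_of_nonneg_left (sum_mul_neg_log_le hμ) hδ
        linarith

theorem sum_fin_succ_arrow {X : Type*} [Fintype X] {n : ℕ} (f : (Fin (n + 1) → X) → ℝ) :
    ∑ x, f x = ∑ a, ∑ y : Fin n → X, f (Fin.cons a y) := by
  classical
  rw [← (Fin.consEquiv fun _ : Fin (n + 1) => X).sum_comp, Fintype.sum_prod_type]
  rfl

/-- Chain rule: the first coordinate through the averaged channel, then the others given it. -/
theorem channelInfo_pi_succ {X B : Type*} [Fintype X] [Fintype B] {n : ℕ} (μ : X → ℝ)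
    (T : (Fin (n + 1) → X) → B → ℝ) :
    channelInfo (fun x => ∏ i, μ (x i)) T
      = ∑ a, μ a * channelInfo (fun y : Fin n → X => ∏ i, μ (y i)) (fun y => T (Fin.cons a y))
        + channelInfo μ fun a z => ∑ y : Fin n → X, (∏ i, μ (y i)) * T (Fin.cons a y) z := by
  unfold channelInfo
  simp only [mul_sum (s := (univ : Finset B))]
  rw [sum_comm (s := (univ : Finset X)) (t := (univ : Finset B)), ← sum_add_distrib]
  refine sum_congr rfl fun z _ => ?_
  simp only [sum_fin_succ_arrow, Fin.prod_univ_succ, Fin.cons_zero, Fin.cons_succ, mul_assoc,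
    ← mul_sum, mul_sub, sum_sub_distrib]
  ring

theorem channelInfo_pi_le {X B : Type*} [Fintype X] [Fintype B] {μ : X → ℝ} {ε δ b : ℝ}
    (hμ : IsPMF μ)
    (hb : ∀ Q : X → B → ℝ, (∀ x, IsPMF (Q x)) → IsDPChannel ε δ Q → channelInfo μ Q ≤ b) (n : ℕ)
    (T : (Fin n → X) → B → ℝ) (hT : ∀ x, IsPMF (T x))
    (hDP : ∀ (S : Finset B) (x x' : Fin n → X) (i : Fin n), (∀ j, j ≠ i → x j = x' j) →
      ∑ z ∈ S, T x z ≤ Real.exp ε * ∑ z ∈ S, T x' z + δ) :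
    channelInfo (fun x => ∏ i, μ (x i)) T ≤ n * b := by
  induction n with
  | zero => simp [channelInfo]
  | succ n ih =>
    have hm := isPMF_pi hμ n
    rw [channelInfo_pi_succ]
    have h1 : ∀ a, channelInfo (fun y : Fin n → X => ∏ i, μ (y i)) (fun y => T (Fin.cons a y))
        ≤ n * b := by
      intro a
      refine ih _ (fun y => hT _) fun S x x' i hx => hDP S _ _ i.succ fun j hj => ?_
      induction j using Fin.cases with
      | zero => rfl
      | succ j => simpa using hx j fun h => hj (h ▸ rfl)
    have h2 := hb (fun a z => ∑ y : Fin n → X, (∏ i, μ (y i)) * T (Fin.cons a y) z)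
      (fun a => isPMF_mix hm fun y => hT _) (by
        intro S a a'
        rw [sum_comm, sum_comm (s := S)]
        simp only [← mul_sum]
        calc _ ≤ ∑ y : Fin n → X, (∏ i, μ (y i))
              * (Real.exp ε * ∑ z ∈ S, T (Fin.cons a' y) z + δ) := by
              refine sum_le_sum fun y _ => mul_le_mul_of_nonneg_left
                (hDP S _ _ 0 fun j hj => ?_) (hm.1 y)
              induction j using Fin.cases with
              | zero => exact absurd rfl hj
              | succ j => rfl
          _ = _ := by
              have := hm.2
              simp only [mul_add, sum_add_distrib, ← sum_mul, this, one_mul, mul_sum]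
              simp only [mul_left_comm])
    have h3 : ∑ a, μ a * channelInfo (fun y : Fin n → X => ∏ i, μ (y i))
        (fun y => T (Fin.cons a y)) ≤ n * b := by
      calc _ ≤ ∑ a, μ a * (n * b) :=
            sum_le_sum fun a _ => mul_le_mul_of_nonneg_left (h1 a) (hμ.1 a)
        _ = n * b := by rw [← sum_mul, hμ.2, one_mul]
    push_cast
    linarith

theorem condMI_eq_sum_channelInfo {V X Z : Type*} [Fintype V] [DecidableEq V] [Fintype X]
    [DecidableEq X] [Fintype Z] [DecidableEq Z] {pV : V → ℝ} {m : V → X → ℝ} {T : X → Z → ℝ}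
    (hm : ∀ v, IsPMF (m v)) (hT : ∀ x, IsPMF (T x)) {joint : V × X × Z → ℝ}
    (hjoint : ∀ ω, joint ω = pV ω.1 * m ω.1 ω.2.1 * T ω.2.1 ω.2.2) :
    condMI joint (fun ω => ω.2.1) (fun ω => ω.2.2) (fun ω => ω.1)
      = ∑ v, pV v * channelInfo (m v) T := by
  obtain rfl : joint = fun ω => pV ω.1 * m ω.1 ω.2.1 * T ω.2.1 ω.2.2 := funext hjoint
  have hV : ent (fun ω : V × X × Z => pV ω.1 * m ω.1 ω.2.1 * T ω.2.1 ω.2.2) (fun ω => ω.1)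
      = ∑ v, Real.negMulLog (pV v) := by
    unfold ent
    refine sum_congr rfl fun v _ => congrArg _ ?_
    simp only [sum_filter, Fintype.sum_prod_type]
    rw [sum_eq_single v (by simp +contextual) (by simp)]
    simp [← mul_sum, (hT _).2, (hm _).2]
  have hXV : ent (fun ω : V × X × Z => pV ω.1 * m ω.1 ω.2.1 * T ω.2.1 ω.2.2)
      (fun ω => (ω.2.1, ω.1)) = ∑ v, ∑ x, Real.negMulLog (pV v * m v x) := by
    unfold ent
    rw [Fintype.sum_prod_type, sum_comm]
    refine sum_congr rfl fun v _ => sum_congr rfl fun x _ => congrArg _ ?_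
    simp only [sum_filter, Fintype.sum_prod_type, Prod.mk.injEq]
    rw [sum_eq_single v (by simp +contextual) (by simp),
      sum_eq_single x (by simp +contextual) (by simp)]
    simp [← mul_sum, (hT _).2]
  have hZV : ent (fun ω : V × X × Z => pV ω.1 * m ω.1 ω.2.1 * T ω.2.1 ω.2.2)
      (fun ω => (ω.2.2, ω.1)) = ∑ v, ∑ z, Real.negMulLog (pV v * ∑ x, m v x * T x z) := by
    unfold ent
    rw [Fintype.sum_prod_type, sum_comm]
    refine sum_congr rfl fun v _ => sum_congr rfl fun z _ => congrArg _ ?_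
    simp only [sum_filter, Fintype.sum_prod_type, Prod.mk.injEq]
    rw [sum_eq_single v (by simp +contextual) (by simp)]
    simp [mul_sum, mul_assoc]
  have hXZV : ent (fun ω : V × X × Z => pV ω.1 * m ω.1 ω.2.1 * T ω.2.1 ω.2.2)
      (fun ω => (ω.2.1, ω.2.2, ω.1))
      = ∑ v, ∑ x, ∑ z, Real.negMulLog (pV v * m v x * T x z) := by
    unfold ent
    simp only [Fintype.sum_prod_type]
    have hpt : ∀ v x z, ∑ ω : V × X × Z with (ω.2.1, ω.2.2, ω.1) = (x, z, v),
        pV ω.1 * m ω.1 ω.2.1 * T ω.2.1 ω.2.2 = pV v * m v x * T x z := by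
      intro v x z
      have : (univ.filter fun ω : V × X × Z => (ω.2.1, ω.2.2, ω.1) = (x, z, v))
          = {(v, x, z)} := by
        ext ⟨v', x', z'⟩
        simp only [mem_filter, mem_univ, true_and, Prod.mk.injEq, mem_singleton]
        tauto
      rw [this, sum_singleton]
    simp only [hpt]
    rw [sum_comm (s := (univ : Finset V))]
    exact sum_congr rfl fun x _ => sum_comm
  unfold condMI
  rw [hV, hXV, hZV, hXZV, ← sum_add_distrib, ← sum_sub_distrib, ← sum_sub_distrib]
  refine sum_congr rfl fun v _ => ?_
  have hM := (isPMF_mix (hm v) hT).2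
  simp only [Real.negMulLog_mul _ (T _ _), Real.negMulLog_mul _ (∑ x, _), sum_add_distrib,
    ← sum_mul, hM, (hT _).2, one_mul, ← mul_sum, channelInfo, sum_sub_distrib, mul_sub]
  rw [sum_comm (s := (univ : Finset Z))]
  simp only [mul_sum, mul_assoc]
  ring

/-- mutual information bound for fully interactive `(ε, δ)`-differentially
private transcripts.  If, conditional on `V`, the data `X_1,…,X_n` are i.i.d. in a finite
set `X0` and the transcript `Z` is `(ε, δ)`-differentially private with respect to
samples differing in one entry, where `(ε, δ)` satisfy the conditions of Assumption A1′,
then `I(X_{≤n}; Z | V) ≤ n · min{9ε, 75ε²}`. -/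
theorem approx_dp_information_bound
    (n : ℕ) (hn : 1 ≤ n)
    (VT X0 ZT : Type) [Fintype VT] [DecidableEq VT]
    [Fintype X0] [DecidableEq X0] [Fintype ZT] [DecidableEq ZT]
    (trans : (Fin n → X0) → ZT → ℝ) (htrans : ∀ x, IsPMF (trans x))
    (ε δ : ℝ) (hε : 0 < ε) (hδ0 : 0 ≤ δ)
    (hDP : ∀ (S : Finset ZT) (x x' : Fin n → X0) (i : Fin n),
      (∀ j, j ≠ i → x j = x' j) →
      ∑ z ∈ S, trans x z ≤ Real.exp ε * ∑ z ∈ S, trans x' z + δ)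
    (hδ1 : δ ≤ min ε 1 / 256)
    (hδ2 : δ * max ε⁻¹ 1 * Real.log (1 / (δ * max ε⁻¹ 1)) ≤ ε ^ 2)
    (hδ3 : δ ≤ min ε (ε ^ 2) / (Real.log (Fintype.card X0)) ^ 2)
    (hδ4 : ε ≤ 1 / 6 →
      δ ≤ ε ^ 5 / (64 * (Real.log (Fintype.card X0)) ^ 2) ∧
      δ * (Real.log (ε / δ)) ^ 2 ≤ ε ^ 5 / 16)
    (pV : VT → ℝ) (hpV : IsPMF pV)
    (μ : VT → X0 → ℝ) (hμ : ∀ v, IsPMF (μ v))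
    (joint : VT × (Fin n → X0) × ZT → ℝ)
    (hjoint : ∀ ω, joint ω = pV ω.1 * (∏ i, μ ω.1 (ω.2.1 i)) * trans ω.2.1 ω.2.2) :
    condMI joint (fun ω => ω.2.1) (fun ω => ω.2.2) (fun ω => ω.1) ≤
      n * min (9 * ε) (75 * ε ^ 2) := by
  have hL : 0 ≤ Real.log (Fintype.card X0) := Real.log_natCast_nonneg _
  set L := Real.log (Fintype.card X0)
  have hmono : δ * L ^ 2 ≤ min ε (ε ^ 2) := mul_le_of_le_div₀ (by positivity) (by positivity) hδ3
  have hδε : δ ≤ ε / 256 := hδ1.trans (by gcongr; exact min_le_left _ _)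
  have hlin : 2 * ε + L * δ + δ ≤ 9 * ε := by
    have h1 : (L * δ) ^ 2 ≤ ε ^ 2 := by
      have := mul_le_mul hδε (hmono.trans (min_le_left _ _)) (by positivity) (by positivity)
      nlinarith
    have := abs_le_of_sq_le_sq h1 hε.le
    linarith [le_of_abs_le this]
  have hquad : ε ≤ 1 / 6 →
      ε * (2 * (δ + (Real.exp ε - 1))) + L * δ + δ ≤ 75 * ε ^ 2 := by
    intro hε6
    obtain ⟨h5, h6⟩ := hδ4 hε6
    have hexp : Real.exp ε - 1 ≤ 2 * ε := by
      have := Real.abs_exp_sub_one_le (x := ε) (by rw [abs_of_pos hε]; linarith)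
      rw [abs_of_pos hε] at this
      exact (le_abs_self _).trans this
    have hε5 : ε ^ 5 ≤ ε ^ 2 := pow_le_pow_of_le_one hε.le (by linarith) (by norm_num)
    have hδsq : δ ≤ ε ^ 2 := by
      rcases hδ0.eq_or_lt with h | h
      · rw [← h]; positivity
      have h7 : 1 ≤ Real.log (ε / δ) := by
        rw [Real.le_log_iff_exp_le (by positivity), le_div_iff₀ h]
        nlinarith [Real.exp_one_lt_d9]
      nlinarith [mul_le_mul_of_nonneg_left (one_le_pow₀ h7 (n := 2)) hδ0]
    have hLδ : L * δ ≤ ε ^ 2 := by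
      have h8 : δ * (64 * L ^ 2) ≤ ε ^ 5 := mul_le_of_le_div₀ (by positivity) (by positivity) h5
      refine le_of_sq_le_sq ?_ (by positivity)
      have := mul_le_mul hδsq (h8.trans hε5) (by positivity) (by positivity)
      nlinarith [sq_nonneg (ε ^ 2)]
    nlinarith [mul_le_mul_of_nonneg_left hexp hε.le, mul_le_mul_of_nonneg_left hδε hε.le]
  have hone : ∀ v, ∀ Q : X0 → ZT → ℝ, (∀ x, IsPMF (Q x)) → IsDPChannel ε δ Q →
      channelInfo (μ v) Q ≤ min (9 * ε) (75 * ε ^ 2) := by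
    intro v Q hQ hQDP
    have h9 : channelInfo (μ v) Q ≤ 9 * ε :=
      (channelInfo_le (hμ v) hQ hε hδ0 hQDP fun p q hp hq _ => sum_abs_sub_le_two hp hq).trans
        (by linarith)
    refine le_min h9 ?_
    rcases le_total ε (1 / 6) with hε6 | hε6
    · exact (channelInfo_le (hμ v) hQ hε hδ0 hQDP fun p q hp hq h =>
        sum_abs_sub_le_of_dp hp hq hε h).trans (hquad hε6)
    · nlinarith
  rw [condMI_eq_sum_channelInfo (fun v => isPMF_pi (hμ v) n) htrans hjoint]
  calc _ ≤ ∑ v, pV v * (n * min (9 * ε) (75 * ε ^ 2)) :=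
        sum_le_sum fun v _ => mul_le_mul_of_nonneg_left
          (channelInfo_pi_le (hμ v) (hone v) n trans htrans hDP) (hpV.1 v)
    _ = _ := by rw [← sum_mul, hpV.2, one_mul]
end

section
/- Let V → X → Z be a Markov chain of discrete random variables, where conditional on V = v the variable X has distribution P_v, and suppose |log(dP_v/dP_{v'})| ≤ α for all v, v'. Then I(V; Z) ≤ 4·(e^α − 1)²·E_Z[ ‖P_X(· | Z) − P_X‖_TV² ] ≤ 2·(e^α − 1)²·I(X; Z), where P_X is the marginal distribution of X and P_X(· | Z) the conditional distribution of X given Z. -/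
open Finset

/-- Total variation distance between pmfs on a finite type. -/
noncomputable def tvD {Ω : Type*} [Fintype Ω] (p q : Ω → ℝ) : ℝ :=
  (1 / 2) * ∑ ω, |p ω - q ω|

open Real in
/-- The scalar lower bound behind Pinsker's inequality. -/
theorem three_mul_sq_div_le_mul_log {u : ℝ} (hu : 0 < u) :
    3 * (u - 1) ^ 2 / (2 * u + 4) ≤ u * log u - u + 1 := by
  set G : ℝ → ℝ := fun x => log x - (x - 1) * (5 * x + 1) / (2 * x * (x + 2)) with hG
  have hd : ∀ x : ℝ, 0 < x → HasDerivAt G ((x - 1) ^ 3 / (x ^ 2 * (x + 2) ^ 2)) x := by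
    intro x hx
    have hnum : HasDerivAt (fun x : ℝ => (x - 1) * (5 * x + 1))
        (1 * (5 * x + 1) + (x - 1) * (5 * 1)) x :=
      ((hasDerivAt_id x).sub_const 1).mul (((hasDerivAt_id x).const_mul 5).add_const 1)
    have hden : HasDerivAt (fun x : ℝ => 2 * x * (x + 2)) (2 * 1 * (x + 2) + 2 * x * 1) x :=
      ((hasDerivAt_id x).const_mul 2).mul ((hasDerivAt_id x).add_const 2)
    refine ((hasDerivAt_log hx.ne').sub (hnum.div hden (by positivity))).congr_deriv ?_
    field_simp
    ring
  have hcont : ContinuousOn G (Set.Ioi 0) := fun x hx => (hd x hx).continuousAt.continuousWithinAt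
  have hG1 : G 1 = 0 := by simp [hG]
  have hGu : 0 ≤ G u := by
    rcases le_total u 1 with h | h
    · have hanti : AntitoneOn G (Set.Icc u 1) := by
        refine antitoneOn_of_deriv_nonpos (convex_Icc u 1)
          (hcont.mono fun x hx => hu.trans_le hx.1) ?_ ?_ <;>
          rw [interior_Icc] <;> intro x hx <;> have hx0 : 0 < x := hu.trans hx.1
        · exact (hd x hx0).differentiableAt.differentiableWithinAt
        · rw [(hd x hx0).deriv]
          refine div_nonpos_of_nonpos_of_nonneg ?_ (by positivity)
          exact Odd.pow_nonpos (by decide) (by linarith [hx.2])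
      simpa [hG1] using hanti (Set.left_mem_Icc.2 h) (Set.right_mem_Icc.2 h) h
    · have hmono : MonotoneOn G (Set.Icc 1 u) := by
        refine monotoneOn_of_deriv_nonneg (convex_Icc 1 u)
          (hcont.mono fun x hx => one_pos.trans_le hx.1) ?_ ?_ <;>
          rw [interior_Icc] <;> intro x hx <;> have hx0 : 0 < x := one_pos.trans hx.1
        · exact (hd x hx0).differentiableAt.differentiableWithinAt
        · rw [(hd x hx0).deriv]
          have : 0 ≤ x - 1 := by linarith [hx.1]
          positivity
      simpa [hG1] using hmono (Set.left_mem_Icc.2 h) (Set.right_mem_Icc.2 h) h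
  have key : u * log u - u + 1 - 3 * (u - 1) ^ 2 / (2 * u + 4) = u * G u := by
    simp only [hG]
    field_simp
    ring
  nlinarith [mul_nonneg hu.le hGu]

open Real in
theorem three_mul_sub_sq_div_le {p q : ℝ} (hp : 0 ≤ p) (hq : 0 < q) :
    3 * (p - q) ^ 2 / (2 * p + 4 * q) ≤ p * (log p - log q) - p + q := by
  rcases hp.eq_or_lt with rfl | hp
  · rw [div_le_iff₀ (by positivity)]
    nlinarith
  · have h := mul_le_mul_of_nonneg_left (three_mul_sq_div_le_mul_log (div_pos hp hq)) hq.le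
    rw [log_div hp.ne' hq.ne'] at h
    have hl : q * (3 * (p / q - 1) ^ 2 / (2 * (p / q) + 4)) =
        3 * (p - q) ^ 2 / (2 * p + 4 * q) := by
      field_simp
    have hr : q * (p / q * (log p - log q) - p / q + 1) = p * (log p - log q) - p + q := by
      field_simp
    rwa [hl, hr] at h

/-- Pinsker's inequality on a finite type. -/
theorem two_mul_tvD_sq_le {X : Type*} [Fintype X] {p q : X → ℝ} (hp : IsPMF p) (hq : IsPMF q)
    (hq0 : ∀ x, 0 < q x) :
    2 * tvD p q ^ 2 ≤ ∑ x, p x * (Real.log (p x) - Real.log (q x)) := by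
  have hden : ∀ x, 0 < (2 * p x + 4 * q x) / 3 := fun x => by
    have := hp.1 x
    have := hq0 x
    positivity
  have hcs := Finset.sq_sum_div_le_sum_sq_div Finset.univ (fun x => |p x - q x|)
    (g := fun x => (2 * p x + 4 * q x) / 3) (fun x _ => hden x)
  have hsum : ∑ x, (2 * p x + 4 * q x) / 3 = 2 := by
    rw [← Finset.sum_div, Finset.sum_add_distrib, ← Finset.mul_sum, ← Finset.mul_sum, hp.2, hq.2]
    norm_num
  rw [hsum] at hcs
  have hpt : ∑ x, |p x - q x| ^ 2 / ((2 * p x + 4 * q x) / 3) ≤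
      ∑ x, (p x * (Real.log (p x) - Real.log (q x)) - p x + q x) := by
    refine Finset.sum_le_sum fun x _ => ?_
    rw [sq_abs, div_div_eq_mul_div, mul_comm]
    exact three_mul_sub_sq_div_le (hp.1 x) (hq0 x)
  rw [Finset.sum_add_distrib, Finset.sum_sub_distrib, hp.2, hq.2] at hpt
  unfold tvD
  linarith

/-- Mutual information as an expected log-ratio of the joint law to its marginals. -/
theorem mi_eq_sum_log {Ω A B : Type*} [Fintype Ω] [Fintype A] [DecidableEq A]
    [Fintype B] [DecidableEq B] (p : Ω → ℝ) (f : Ω → A) (g : Ω → B) (r : A → B → ℝ)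
    (hr : ∀ a b, ∑ ω ∈ Finset.univ.filter (fun ω => (f ω, g ω) = (a, b)), p ω = r a b) :
    mi p f g = ∑ b, ∑ a, r a b *
      (Real.log (r a b) - Real.log (∑ b', r a b') - Real.log (∑ a', r a' b)) := by
  have h1 : ∀ a, ∑ ω ∈ Finset.univ.filter (fun ω => f ω = a), p ω = ∑ b, r a b := fun a => by
    rw [← Finset.sum_fiberwise _ g]
    simp_rw [Finset.filter_filter, ← hr, Prod.mk.injEq]
  have h2 : ∀ b, ∑ ω ∈ Finset.univ.filter (fun ω => g ω = b), p ω = ∑ a, r a b := fun b => by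
    rw [← Finset.sum_fiberwise _ f]
    simp_rw [Finset.filter_filter, ← hr, Prod.mk.injEq, and_comm]
  simp only [mi, ent, h1, h2, Fintype.sum_prod_type, hr, Real.negMulLog]
  simp only [mul_sub, Finset.sum_sub_distrib, ← Finset.sum_mul, neg_mul, Finset.sum_neg_distrib]
  rw [Finset.sum_comm (f := fun b a => r a b * Real.log (r a b)),
    Finset.sum_comm (f := fun b a => r a b * Real.log (∑ b', r a b'))]
  simp only [← Finset.sum_mul]
  ring

/-- If every conditional weight `k` stays within relative distance `c` of the marginal weight `q`,
its log-likelihood contribution is at most the corresponding chi-square term. -/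
theorem mul_log_sub_log_le {w k q c : ℝ} (hw : 0 ≤ w) (hk : 0 ≤ k) (hq : 0 ≤ q)
    (hqk : q = 0 → w * k = 0) (hc : |k - q| ≤ q * c) :
    w * k * (Real.log (w * k) - Real.log w - Real.log q) ≤ w * (q * c ^ 2 + k - q) := by
  rcases hq.eq_or_lt with rfl | hq
  · have := hqk rfl
    simp [this]
  rcases hw.eq_or_lt with rfl | hw
  · simp
  rw [mul_assoc]
  refine mul_le_mul_of_nonneg_left ?_ hw.le
  have hsq : (k - q) ^ 2 ≤ (q * c) ^ 2 := by
    rw [← sq_abs]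
    exact pow_le_pow_left₀ (abs_nonneg _) hc 2
  have hchi : k * (k / q - 1) ≤ q * c ^ 2 + k - q := by
    have : k * (k / q - 1) = (k - q) ^ 2 / q + k - q := by
      field_simp
      ring
    have : (k - q) ^ 2 / q ≤ q * c ^ 2 := by
      rw [div_le_iff₀ hq]
      nlinarith
    linarith
  rcases hk.eq_or_lt with rfl | hk
  · simpa using hchi
  refine le_trans (mul_le_mul_of_nonneg_left ?_ hk.le) hchi
  rw [Real.log_mul hw.ne' hk.ne', add_sub_cancel_left, ← Real.log_div hk.ne' hq.ne']
  exact Real.log_le_sub_one_of_pos (div_pos hk hq)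

/-- A mixture density stays within relative distance `exp α - 1` of each of its components. -/
theorem abs_sub_mixture_le {V : Type*} [Fintype V] {w f : V → ℝ} (hw : IsPMF w)
    (hf : ∀ v, 0 < f v) {α : ℝ} (hα : ∀ v v', |Real.log (f v / f v')| ≤ α) (v : V) :
    |f v - ∑ u, w u * f u| ≤ (Real.exp α - 1) * ∑ u, w u * f u := by
  have hle : ∀ a b, f a ≤ Real.exp α * f b := fun a b => by
    rw [← div_le_iff₀ (hf b)]
    exact (Real.log_le_iff_le_exp (div_pos (hf a) (hf b))).1 (le_of_abs_le (hα a b))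
  have hup : f v ≤ Real.exp α * ∑ u, w u * f u := by
    calc f v = ∑ u, w u * f v := by rw [← Finset.sum_mul, hw.2, one_mul]
      _ ≤ ∑ u, w u * (Real.exp α * f u) :=
        Finset.sum_le_sum fun u _ => mul_le_mul_of_nonneg_left (hle v u) (hw.1 u)
      _ = _ := by
        rw [Finset.mul_sum]
        exact Finset.sum_congr rfl fun u _ => by ring
  have hlow : ∑ u, w u * f u ≤ Real.exp α * f v := by
    calc ∑ u, w u * f u ≤ ∑ u, w u * (Real.exp α * f v) :=
        Finset.sum_le_sum fun u _ => mul_le_mul_of_nonneg_left (hle u v) (hw.1 u)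
      _ = _ := by rw [← Finset.sum_mul, hw.2, one_mul]
  have hm : 0 ≤ ∑ u, w u * f u :=
    Finset.sum_nonneg fun u _ => mul_nonneg (hw.1 u) (hf u).le
  have he := Real.exp_pos α
  rw [abs_le]
  constructor
  · by_contra! h
    nlinarith [sq_nonneg (Real.exp α - 1)]
  · linarith

/-- The probability of `z` under the component `f` differs from its probability `q` under the
marginal `m` by at most `2 c q` times the total variation distance between posterior and
prior. -/
theorem abs_sum_mul_sub_le {X : Type*} [Fintype X] {f m k : X → ℝ} (hf : ∑ x, f x = 1)
    (hm : ∑ x, m x = 1) (hm0 : ∀ x, 0 < m x) {c : ℝ} (hc : ∀ x, |f x - m x| ≤ c * m x)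
    (hq : 0 < ∑ x, m x * k x) :
    |∑ x, f x * k x - ∑ x, m x * k x| ≤
      (∑ x, m x * k x) * (2 * c * tvD (fun x => m x * k x / ∑ y, m y * k y) m) := by
  set q := ∑ x, m x * k x with hqd
  have hid : ∑ x, f x * k x - q =
      q * ∑ x, (f x - m x) / m x * (m x * k x / q - m x) := by
    have : ∀ x, q * ((f x - m x) / m x * (m x * k x / q - m x)) =
        f x * k x - m x * k x - q * (f x - m x) := fun x => by
      have := (hm0 x).ne'
      field_simp
    rw [Finset.mul_sum, Finset.sum_congr rfl fun x _ => this x]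
    rw [Finset.sum_sub_distrib, Finset.sum_sub_distrib, ← Finset.mul_sum, Finset.sum_sub_distrib,
      hf, hm, ← hqd]
    ring
  rw [hid, abs_mul, abs_of_pos hq]
  refine mul_le_mul_of_nonneg_left ?_ hq.le
  unfold tvD
  rw [show ∀ S : ℝ, 2 * c * (1 / 2 * S) = c * S from fun S => by ring, Finset.mul_sum]
  refine (Finset.abs_sum_le_sum_abs _ _).trans (Finset.sum_le_sum fun x _ => ?_)
  rw [abs_mul]
  refine mul_le_mul_of_nonneg_right ?_ (abs_nonneg _)
  rw [abs_div, abs_of_pos (hm0 x), div_le_iff₀ (hm0 x)]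
  exact hc x

/-- strong data processing for bounded likelihood ratios.  For a Markov
chain `V → X → Z` of discrete random variables with `X ~ P_v` given `V = v` and
`|log(dP_v/dP_{v'})| ≤ α`, the mutual information `I(V; Z)` is bounded by
`4(e^α − 1)² E_Z[‖P_X(·|Z) − P_X‖_TV²]`, which is itself at most `2(e^α − 1)² I(X; Z)`. -/
theorem sdp_for_bounded_likelihood
    (VT X0 ZT : Type) [Fintype VT] [DecidableEq VT]
    [Fintype X0] [DecidableEq X0] [Fintype ZT] [DecidableEq ZT]
    (pV : VT → ℝ) (hpV : IsPMF pV)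
    (Pm : VT → X0 → ℝ) (hPm : ∀ v, IsPMF (Pm v)) (hpos : ∀ v x, 0 < Pm v x)
    (α : ℝ) (hα : ∀ v v' x, |Real.log (Pm v x / Pm v' x)| ≤ α)
    (K : X0 → ZT → ℝ) (hK : ∀ x, IsPMF (K x))
    (joint : VT × X0 × ZT → ℝ)
    (hjoint : ∀ ω, joint ω = pV ω.1 * Pm ω.1 ω.2.1 * K ω.2.1 ω.2.2) :
    mi joint (fun ω => ω.1) (fun ω => ω.2.2) ≤
      4 * (Real.exp α - 1) ^ 2 *
        ∑ z : ZT, (∑ ω ∈ Finset.univ.filter (fun ω : VT × X0 × ZT => ω.2.2 = z), joint ω) *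
          (tvD (fun x => (∑ v : VT, joint (v, x, z)) /
              (∑ ω ∈ Finset.univ.filter (fun ω : VT × X0 × ZT => ω.2.2 = z), joint ω))
            (fun x => ∑ v : VT, pV v * Pm v x)) ^ 2 ∧
    4 * (Real.exp α - 1) ^ 2 *
        ∑ z : ZT, (∑ ω ∈ Finset.univ.filter (fun ω : VT × X0 × ZT => ω.2.2 = z), joint ω) *
          (tvD (fun x => (∑ v : VT, joint (v, x, z)) /
              (∑ ω ∈ Finset.univ.filter (fun ω : VT × X0 × ZT => ω.2.2 = z), joint ω))
            (fun x => ∑ v : VT, pV v * Pm v x)) ^ 2 ≤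
      2 * (Real.exp α - 1) ^ 2 * mi joint (fun ω => ω.2.1) (fun ω => ω.2.2) := by
  set m : X0 → ℝ := fun x => ∑ v, pV v * Pm v x with hm
  set k : VT → ZT → ℝ := fun v z => ∑ x, Pm v x * K x z with hk
  set q : ZT → ℝ := fun z => ∑ x, m x * K x z with hq
  obtain ⟨v₀⟩ : Nonempty VT := by
    by_contra h
    rw [not_nonempty_iff] at h
    simpa using hpV.2
  have hm1 : ∑ x, m x = 1 := by
    simp only [hm]
    rw [Finset.sum_comm]
    simp only [← Finset.mul_sum, (hPm _).2, mul_one, hpV.2]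
  have hmpos : ∀ x, 0 < m x := fun x => by
    obtain ⟨v, -, hv⟩ : ∃ v ∈ Finset.univ, 0 < pV v :=
      Finset.exists_lt_of_sum_lt (f := fun _ => (0 : ℝ)) (by simp [hpV.2])
    exact Finset.sum_pos' (fun u _ => mul_nonneg (hpV.1 u) (hpos u x).le)
      ⟨v, Finset.mem_univ v, mul_pos hv (hpos v x)⟩
  have hq0 : ∀ z, 0 ≤ q z := fun z =>
    Finset.sum_nonneg fun x _ => mul_nonneg (hmpos x).le ((hK x).1 z)
  have hk0 : ∀ v z, 0 ≤ k v z := fun v z =>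
    Finset.sum_nonneg fun x _ => mul_nonneg (hpos v x).le ((hK x).1 z)
  have hk1 : ∀ v, ∑ z, pV v * k v z = pV v := fun v => by
    simp only [hk]
    rw [← Finset.mul_sum, Finset.sum_comm]
    simp only [← Finset.mul_sum, (hK _).2, mul_one, (hPm v).2]
  have hmix : ∀ z, ∑ v, pV v * k v z = q z := fun z => by
    simp only [hk, hq, hm, Finset.mul_sum, Finset.sum_mul]
    rw [Finset.sum_comm]
    simp only [mul_assoc]
  have hjx : ∀ x z, ∑ v, joint (v, x, z) = m x * K x z := fun x z => by
    simp only [hjoint, hm, Finset.sum_mul]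
  have hjz : ∀ z, ∑ ω ∈ Finset.univ.filter (fun ω : VT × X0 × ZT => ω.2.2 = z), joint ω = q z := by
    intro z
    rw [Finset.sum_filter]
    simp only [Fintype.sum_prod_type, Finset.sum_ite_eq', Finset.mem_univ, if_true]
    rw [Finset.sum_comm]
    simp only [hjx, hq]
  have hVZ : ∀ v z, ∑ ω ∈ Finset.univ.filter
      (fun ω : VT × X0 × ZT => (ω.1, ω.2.2) = (v, z)), joint ω = pV v * k v z := by
    intro v z
    rw [Finset.sum_filter]
    simp only [Fintype.sum_prod_type, Prod.mk.injEq, ite_and, Finset.sum_ite_irrel,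
      Finset.sum_const_zero, Finset.sum_ite_eq', Finset.mem_univ, if_true, hjoint, hk,
      Finset.mul_sum, mul_assoc]
  have hXZ : ∀ x z, ∑ ω ∈ Finset.univ.filter
      (fun ω : VT × X0 × ZT => (ω.2.1, ω.2.2) = (x, z)), joint ω = m x * K x z := by
    intro x z
    rw [Finset.sum_filter]
    simp only [Fintype.sum_prod_type, Prod.mk.injEq, ite_and, Finset.sum_ite_irrel,
      Finset.sum_const_zero, Finset.sum_ite_eq', Finset.mem_univ, if_true, hjx]
  have hK1 : ∀ x, ∑ z, m x * K x z = m x := fun x => by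
    rw [← Finset.mul_sum, (hK x).2, mul_one]
  rw [mi_eq_sum_log _ _ _ _ hVZ, mi_eq_sum_log _ _ _ _ hXZ]
  simp only [hjz, hjx, hk1, hmix, hK1]
  constructor
  · rw [Finset.mul_sum]
    refine Finset.sum_le_sum fun z _ => ?_
    set T := tvD (fun x => m x * K x z / q z) m
    have hdist : ∀ v, 0 < q z → |k v z - q z| ≤ q z * (2 * (Real.exp α - 1) * T) := fun v h =>
      abs_sum_mul_sub_le (hPm v).2 hm1 hmpos
        (fun x => abs_sub_mixture_le hpV (fun u => hpos u x) (fun u u' => hα u u' x) v) h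
    rcases (hq0 z).eq_or_lt with h | h
    · have hzero : ∀ v, pV v * k v z = 0 := fun v =>
        (Finset.sum_eq_zero_iff_of_nonneg fun u _ => mul_nonneg (hpV.1 u) (hk0 u z)).1
          ((hmix z).trans h.symm) v (Finset.mem_univ v)
      simp [hzero, ← h]
    · calc _ ≤ ∑ v, pV v * (q z * (2 * (Real.exp α - 1) * T) ^ 2 + k v z - q z) :=
          Finset.sum_le_sum fun v _ => mul_log_sub_log_le (hpV.1 v) (hk0 v z) (hq0 z)
            (fun h' => absurd h' h.ne') (hdist v h)
        _ = _ := by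
          simp only [mul_sub, mul_add, Finset.sum_sub_distrib, Finset.sum_add_distrib,
            ← Finset.sum_mul, hpV.2, hmix]
          ring
  · rw [Finset.mul_sum, Finset.mul_sum]
    refine Finset.sum_le_sum fun z _ => ?_
    rcases (hq0 z).eq_or_lt with h | h
    · have hzero : ∀ x, m x * K x z = 0 := fun x =>
        (Finset.sum_eq_zero_iff_of_nonneg fun u _ => mul_nonneg (hmpos u).le ((hK u).1 z)).1
          h.symm x (Finset.mem_univ x)
      simp [hzero, ← h]
    · have hpost : IsPMF fun x => m x * K x z / q z :=
        ⟨fun x => div_nonneg (mul_nonneg (hmpos x).le ((hK x).1 z)) h.le, by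
          rw [← Finset.sum_div]
          exact div_self h.ne'⟩
      have hpin := two_mul_tvD_sq_le hpost ⟨fun x => (hmpos x).le, hm1⟩ hmpos
      have hsum : ∑ x, m x * K x z *
            (Real.log (m x * K x z) - Real.log (m x) - Real.log (q z)) =
          q z * ∑ x, m x * K x z / q z *
            (Real.log (m x * K x z / q z) - Real.log (m x)) := by
        rw [Finset.mul_sum]
        refine Finset.sum_congr rfl fun x _ => ?_
        by_cases hx : m x * K x z = 0
        · simp [hx]
        · rw [Real.log_div hx h.ne', ← mul_assoc, mul_div_cancel₀ _ h.ne']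
          ring
      rw [show ∑ x, m x * K x z = q z from rfl, hsum]
      have := mul_le_mul_of_nonneg_left hpin
        (mul_nonneg (mul_nonneg zero_le_two (sq_nonneg (Real.exp α - 1))) h.le)
      linarith
end

section
/- Let V be a random vector with d coordinates and let X_{≤n} = (X_1,…,X_n) with each X_i ∈ 𝒳^d be such that, conditional on V, the coordinate blocks X_{≤n,1}, …, X_{≤n,d} (where X_{≤n,j} = (X_{1,j},…,X_{n,j}) collects the j-th coordinates) are mutually independent, with X_{≤n,j} depending only on V_j. Then for any random variable Z, Σ_{j=1}^d I(X_{≤n,j}; Z | V) ≤ I(X_{≤n}; Z | V). -/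
open Finset

/-- The mass that `p` gives to the event `f = a`. -/
noncomputable def fiberMass {Ω A : Type*} [Fintype Ω] [DecidableEq A]
    (p : Ω → ℝ) (f : Ω → A) (a : A) : ℝ :=
  ∑ ω ∈ univ.filter (fun ω => f ω = a), p ω

section Entropy

variable {Ω A B C ι : Type*} [Fintype Ω] [DecidableEq A] [DecidableEq B] [DecidableEq C]
  [Fintype ι] {p : Ω → ℝ}

lemma fiberMass_nonneg (hp : ∀ ω, 0 ≤ p ω) (f : Ω → A) (a : A) : 0 ≤ fiberMass p f a :=
  sum_nonneg fun ω _ => hp ω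

lemma fiberMass_pos (hp : ∀ ω, 0 ≤ p ω) (f : Ω → A) {ω : Ω} (hω : 0 < p ω) :
    0 < fiberMass p f (f ω) :=
  hω.trans_le (single_le_sum (f := p) (fun ω _ => hp ω) (by simp))

variable [Fintype A]

lemma sum_mul_comp_eq_sum_fiberMass_mul (p : Ω → ℝ) (f : Ω → A) (g : A → ℝ) :
    ∑ ω, p ω * g (f ω) = ∑ a, fiberMass p f a * g a := by
  rw [← sum_fiberwise univ f]
  refine sum_congr rfl fun a _ => ?_
  rw [fiberMass, sum_mul]
  refine sum_congr rfl fun ω hω => ?_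
  rw [(mem_filter.1 hω).2]

lemma fiberMass_comp (p : Ω → ℝ) (f : Ω → A) (g : A → B) (b : B) :
    fiberMass p (fun ω => g (f ω)) b = ∑ a, if g a = b then fiberMass p f a else 0 := by
  have h := sum_mul_comp_eq_sum_fiberMass_mul p f (fun a => if g a = b then 1 else 0)
  simpa [fiberMass, sum_filter] using h

lemma sum_fiberMass (p : Ω → ℝ) (f : Ω → A) : ∑ a, fiberMass p f a = ∑ ω, p ω := by
  simpa using (sum_mul_comp_eq_sum_fiberMass_mul p f (fun _ => 1)).symm

lemma ent_eq_neg_sum_mul_log (p : Ω → ℝ) (f : Ω → A) :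
    ent p f = -∑ ω, p ω * Real.log (fiberMass p f (f ω)) := by
  rw [sum_mul_comp_eq_sum_fiberMass_mul p f (fun a => Real.log (fiberMass p f a)), ent,
    ← sum_neg_distrib]
  exact sum_congr rfl fun a _ => by rw [Real.negMulLog, fiberMass, neg_mul]

/-- The conditionally independent coupling of the laws of the pairs `(f j, c)` given `c`. -/
noncomputable def condProd (p : Ω → ℝ) (f : ι → Ω → B) (c : Ω → C) (y : (ι → B) × C) : ℝ :=
  fiberMass p c y.2 * ∏ j, (fiberMass p (fun ω => (f j ω, c ω)) (y.1 j, y.2) / fiberMass p c y.2)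

lemma condProd_nonneg (hp : ∀ ω, 0 ≤ p ω) (f : ι → Ω → B) (c : Ω → C) (y : (ι → B) × C) :
    0 ≤ condProd p f c y :=
  mul_nonneg (fiberMass_nonneg hp _ _) (prod_nonneg fun _ _ =>
    div_nonneg (fiberMass_nonneg hp _ _) (fiberMass_nonneg hp _ _))

lemma condProd_pos (hp : ∀ ω, 0 ≤ p ω) (f : ι → Ω → B) (c : Ω → C) {ω : Ω} (hω : 0 < p ω) :
    0 < condProd p f c (fun j => f j ω, c ω) :=
  mul_pos (fiberMass_pos hp c hω) (prod_pos fun j _ =>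
    div_pos (fiberMass_pos hp (fun ω => (f j ω, c ω)) hω) (fiberMass_pos hp c hω))

variable [Fintype B]

/-- Entropy depends only on the partition induced by the random variable. -/
lemma ent_congr (p : Ω → ℝ) {f : Ω → A} {g : Ω → B} (h : ∀ ω ω', f ω = f ω' ↔ g ω = g ω') :
    ent p f = ent p g := by
  simp only [ent_eq_neg_sum_mul_log, fiberMass, h]

variable [Fintype C]

lemma sum_fiberMass_prodMk (p : Ω → ℝ) (f : Ω → A) (g : Ω → C) (c : C) :
    ∑ a, fiberMass p (fun ω => (f ω, g ω)) (a, c) = fiberMass p g c := by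
  rw [fiberMass_comp p (fun ω => (f ω, g ω)) Prod.snd c, Fintype.sum_prod_type]
  simp

lemma sum_mul_log_condProd (hp : ∀ ω, 0 ≤ p ω) (f : ι → Ω → B) (c : Ω → C) :
    ∑ ω, p ω * Real.log (condProd p f c (fun j => f j ω, c ω)) =
      -ent p c - ∑ j, (ent p (fun ω => (f j ω, c ω)) - ent p c) := by
  simp only [ent_eq_neg_sum_mul_log, neg_neg, neg_sub_neg, ← sum_sub_distrib]
  rw [sum_comm, ← sum_sub_distrib]
  refine sum_congr rfl fun ω _ => ?_
  rcases (hp ω).eq_or_lt with h | h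
  · simp [← h]
  have hc := (fiberMass_pos hp c h).ne'
  have hf j := (fiberMass_pos hp (fun ω => (f j ω, c ω)) h).ne'
  rw [condProd, Real.log_mul hc (prod_ne_zero_iff.2 fun j _ => div_ne_zero (hf j) hc),
    Real.log_prod fun j _ => div_ne_zero (hf j) hc, mul_add, mul_sum, sub_eq_add_neg,
    ← sum_neg_distrib]
  congr 1
  refine sum_congr rfl fun j _ => ?_
  rw [Real.log_div (hf j) hc]
  ring

variable [DecidableEq ι]

lemma sum_condProd (p : Ω → ℝ) (f : ι → Ω → B) (c : Ω → C) :
    ∑ y, condProd p f c y = ∑ ω, p ω := by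
  rw [Fintype.sum_prod_type_right, ← sum_fiberMass p c]
  refine sum_congr rfl fun v _ => ?_
  simp only [condProd]
  rw [← mul_sum, ← Fintype.piFinset_univ,
    ← prod_univ_sum (fun _ => univ)
      (fun j b => fiberMass p (fun ω => (f j ω, c ω)) (b, v) / fiberMass p c v)]
  by_cases hv : fiberMass p c v = 0
  · simp [hv]
  · simp [← sum_div, sum_fiberMass_prodMk, hv]

/-- Subadditivity of conditional entropy. -/
lemma ent_pi_sub_le_sum (hp : ∀ ω, 0 ≤ p ω) (f : ι → Ω → B) (c : Ω → C) :
    ent p (fun ω => (fun j => f j ω, c ω)) - ent p c ≤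
      ∑ j, (ent p (fun ω => (f j ω, c ω)) - ent p c) := by
  set F : Ω → (ι → B) × C := fun ω => (fun j => f j ω, c ω) with hF
  have key : ∑ ω, p ω * Real.log (condProd p f c (F ω)) ≤
      ∑ ω, p ω * Real.log (fiberMass p F (F ω)) := by
    have hpt : ∀ ω, p ω * Real.log (condProd p f c (F ω)) -
        p ω * Real.log (fiberMass p F (F ω)) ≤
        p ω * (condProd p f c (F ω) / fiberMass p F (F ω)) - p ω := by
      intro ω
      rcases (hp ω).eq_or_lt with h | h
      · simp [← h]
      have hq := condProd_pos hp f c h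
      have hm := fiberMass_pos hp F h
      have := Real.log_le_sub_one_of_pos (div_pos hq hm)
      rw [Real.log_div hq.ne' hm.ne'] at this
      nlinarith
    have hsum := sum_le_sum fun ω (_ : ω ∈ univ) => hpt ω
    rw [sum_sub_distrib, sum_sub_distrib, sum_mul_comp_eq_sum_fiberMass_mul p F
      (fun y => condProd p f c y / fiberMass p F y)] at hsum
    have hle : ∑ y, fiberMass p F y * (condProd p f c y / fiberMass p F y) ≤ ∑ ω, p ω := by
      rw [← sum_condProd p f c]
      refine sum_le_sum fun y _ => ?_
      by_cases hy : fiberMass p F y = 0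
      · simpa [hy] using condProd_nonneg hp f c y
      · rw [mul_div_cancel₀ _ hy]
    linarith
  rw [sum_mul_log_condProd hp] at key
  rw [ent_eq_neg_sum_mul_log p F]
  linarith

/-- Conditional entropy is additive over conditionally independent variables. -/
lemma ent_pi_sub_eq_sum (hp : ∀ ω, 0 ≤ p ω) (f : ι → Ω → B) (c : Ω → C)
    (r : C → ℝ) (κ : ι → C → B → ℝ) (hκ : ∀ j v, ∑ b, κ j v b = 1)
    (h : ∀ y v, fiberMass p (fun ω => (fun j => f j ω, c ω)) (y, v) = r v * ∏ j, κ j v (y j)) :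
    ent p (fun ω => (fun j => f j ω, c ω)) - ent p c =
      ∑ j, (ent p (fun ω => (f j ω, c ω)) - ent p c) := by
  have hc : ∀ v, fiberMass p c v = r v := by
    intro v
    rw [← sum_fiberMass_prodMk p (fun ω j => f j ω) c v]
    simp only [h]
    rw [← mul_sum, ← Fintype.piFinset_univ, ← prod_univ_sum (fun _ => univ) (fun j => κ j v)]
    simp [hκ]
  have hf : ∀ j b v, fiberMass p (fun ω => (f j ω, c ω)) (b, v) = r v * κ j v b := by
    intro j b v
    rw [fiberMass_comp p (fun ω => (fun j => f j ω, c ω)) (fun y => (y.1 j, y.2)) (b, v),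
      Fintype.sum_prod_type_right]
    have hterm : ∀ y : ι → B, (if y j = b then r v * ∏ k, κ k v (y k) else 0) =
        r v * ∏ k, (κ k v (y k) * if k = j → y k = b then 1 else 0) := by
      intro y
      rw [prod_mul_distrib, prod_boole]
      simp
    have hfac : ∀ k, ∑ b', (κ k v b' * if k = j → b' = b then 1 else 0) =
        if k = j then κ j v b else 1 := by
      intro k
      by_cases hk : k = j
      · subst hk; simp
      · simp [hk, hκ]
    calc _ = ∑ y : ι → B, if y j = b then r v * ∏ k, κ k v (y k) else 0 := by
          rw [sum_eq_single v] <;> simp +contextual [h]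
      _ = r v * κ j v b := by
          simp only [hterm]
          rw [← mul_sum, ← Fintype.piFinset_univ, ← prod_univ_sum (fun _ => univ)
            (fun k b' => κ k v b' * if k = j → b' = b then 1 else 0)]
          simp_rw [hfac]
          simp
  have key : ∀ y, condProd p f c y = fiberMass p (fun ω => (fun j => f j ω, c ω)) y := by
    rintro ⟨y, v⟩
    rw [h, condProd]
    simp only [hc, hf]
    by_cases hv : r v = 0
    · simp [hv]
    · simp [mul_div_cancel_left₀ _ hv]
  have hsum := sum_mul_log_condProd hp f c
  simp only [key] at hsum
  rw [ent_eq_neg_sum_mul_log p (fun ω => (fun j => f j ω, c ω)), hsum]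
  ring

end Entropy

/-- tensorization of conditional information.  If, conditional on `V`, the
coordinate blocks `X_{≤n,1}, …, X_{≤n,d}` of the data are mutually independent with block
`j` depending only on `V_j`, then for any random variable `Z` (arbitrarily jointly
distributed), `Σ_j I(X_{≤n,j}; Z | V) ≤ I(X_{≤n}; Z | V)`. -/
theorem coordinate_information_tensorization
    (d n : ℕ)
    (VT X0 ZT : Type) [Fintype VT] [DecidableEq VT]
    [Fintype X0] [DecidableEq X0] [Fintype ZT] [DecidableEq ZT]
    (pV : (Fin d → VT) → ℝ) (hpV : IsPMF pV)
    (μ : Fin d → VT → (Fin n → X0) → ℝ) (hμ : ∀ j v, IsPMF (μ j v))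
    (joint : (Fin d → VT) × (Fin n → Fin d → X0) × ZT → ℝ)
    (hjoint : IsPMF joint) (hnn : ∀ ω, 0 ≤ joint ω)
    (hmarg : ∀ (v : Fin d → VT) (x : Fin n → Fin d → X0),
      ∑ z : ZT, joint (v, x, z) = pV v * ∏ j, μ j (v j) (fun i => x i j)) :
    ∑ j : Fin d,
        condMI joint (fun ω => fun i => ω.2.1 i j) (fun ω => ω.2.2) (fun ω => ω.1) ≤
      condMI joint (fun ω => ω.2.1) (fun ω => ω.2.2) (fun ω => ω.1) := by
  have hblock : ∀ {T : Type} [Fintype T] [DecidableEq T]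
      (c : (Fin d → VT) × (Fin n → Fin d → X0) × ZT → T),
      ent joint (fun ω => (ω.2.1, c ω)) =
        ent joint (fun ω => ((fun j i => ω.2.1 i j : Fin d → Fin n → X0), c ω)) := by
    intro T _ _ c
    refine ent_congr joint fun ω ω' => ?_
    simp only [Prod.mk.injEq, funext_iff]
    rw [forall_comm]
  have hind := ent_pi_sub_eq_sum hnn (fun j ω i => ω.2.1 i j) (fun ω => ω.1) pV
    (fun j v => μ j (v j)) (fun j v => (hμ j (v j)).2) (by
      intro y v
      rw [← hmarg v (fun i j => y j i), fiberMass, sum_filter, Fintype.sum_prod_type,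
        sum_eq_single v, Fintype.sum_prod_type, sum_eq_single (fun i j => y j i)]
      · simp
      · intro x _ hx
        have : ¬(fun j i => x i j) = y := by rintro rfl; exact hx rfl
        simp [this]
      · simp
      · intro v' _ hv
        simp [hv]
      · simp)
  have hsub := ent_pi_sub_le_sum hnn (fun j ω i => ω.2.1 i j) (fun ω => (ω.2.2, ω.1))
  rw [← hblock] at hind hsub
  have hsplit : ∑ j : Fin d,
      condMI joint (fun ω => fun i => ω.2.1 i j) (fun ω => ω.2.2) (fun ω => ω.1) =
      ∑ j : Fin d, (ent joint (fun ω => (fun i => ω.2.1 i j, ω.1)) - ent joint (fun ω => ω.1)) -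
      ∑ j : Fin d, (ent joint (fun ω => (fun i => ω.2.1 i j, ω.2.2, ω.1)) -
        ent joint (fun ω => (ω.2.2, ω.1))) := by
    rw [← sum_sub_distrib]
    refine sum_congr rfl fun j _ => ?_
    rw [condMI]
    ring
  rw [hsplit, ← hind, condMI]
  linarith
end

section
/- Let X_1,…,X_n be i.i.d. discrete random variables taking values in a finite set 𝒳, let Z be a discrete random variable, and define the privacy-loss Λ_i(x_{≤i}, z) = log[ P(X_i = x_i | Z = z, X_{<i} = x_{<i}) / P(X_i = x_i) ]. Then for any event G ⊆ 𝒳^i × 𝒵, E[ Λ_i(X_{≤i}, Z) · 1{(X_{≤i}, Z) ∉ G} ] ≤ P((X_{≤i}, Z) ∉ G)·log|𝒳| + h₂( P((X_{≤i}, Z) ∉ G) ), where h₂(p) = −p log p − (1 − p) log(1 − p) is the binary entropy. -/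
open Finset

/-- Binary entropy (natural logarithm). -/
noncomputable def h2 (p : ℝ) : ℝ := Real.negMulLog p + Real.negMulLog (1 - p)

/-- Under a product of probability mass functions on `X0`, the expectation of `1 / μ (x i)` is the
size of the support of `μ`, hence at most the cardinality of `X0`. -/
theorem sum_prod_div_apply_le_card {ι X0 : Type*} [Fintype ι] [DecidableEq ι] [Fintype X0]
    {μ : X0 → ℝ} (hμ : IsPMF μ) (i : ι) :
    ∑ x : ι → X0, (∏ j, μ (x j)) / μ (x i) ≤ Fintype.card X0 := by
  have h (x : ι → X0) : (∏ j, μ (x j)) / μ (x i) =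
      ∏ j, (if j = i then μ (x j) / μ (x j) else μ (x j)) := by
    rw [← Finset.mul_prod_erase univ _ (mem_univ i),
      ← Finset.mul_prod_erase univ (fun j => if j = i then _ else _) (mem_univ i),
      if_pos rfl, mul_div_right_comm]
    congr 1
    exact Finset.prod_congr rfl fun j hj => (if_neg (Finset.ne_of_mem_erase hj)).symm
  calc ∑ x : ι → X0, (∏ j, μ (x j)) / μ (x i)
      = ∏ j, ∑ a, (if j = i then μ a / μ a else μ a) := by
        rw [Finset.prod_univ_sum, Fintype.piFinset_univ]
        exact Finset.sum_congr rfl fun x _ => h x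
    _ = ∑ a, μ a / μ a := by
        rw [← Finset.mul_prod_erase univ _ (mem_univ i),
          Finset.prod_eq_one fun j hj => by simpa [Finset.ne_of_mem_erase hj] using hμ.2]
        simp
    _ ≤ ∑ _a : X0, (1 : ℝ) := Finset.sum_le_sum fun a _ => div_self_le_one _
    _ = Fintype.card X0 := by simp

/-- control of the privacy-loss random variable off an arbitrary event.
`X_1,…,X_n` are i.i.d. with common pmf `μ` on the finite set `X0`, `Z` is a discrete
random variable jointly distributed with them via `joint`, the privacy loss is
`Λ_i(x_{≤i}, z) = log[P(X_i = x_i | Z = z, X_{<i} = x_{<i}) / P(X_i = x_i)]`, and `G` is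
any event depending only on `(x_{≤i}, z)`. -/
theorem privacy_loss_off_event_bound
    (n : ℕ) (X0 ZT : Type) [Fintype X0] [DecidableEq X0] [Fintype ZT] [DecidableEq ZT]
    (μ : X0 → ℝ) (hμ : IsPMF μ)
    (joint : (Fin n → X0) × ZT → ℝ) (hjoint : IsPMF joint)
    (hmarg : ∀ x : Fin n → X0, ∑ z : ZT, joint (x, z) = ∏ i, μ (x i))
    (i : Fin n)
    (Λ : (Fin n → X0) × ZT → ℝ)
    (hΛ : ∀ ω : (Fin n → X0) × ZT, Λ ω =
      Real.log
        (((∑ x' ∈ Finset.univ.filter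
              (fun x' : Fin n → X0 => ∀ j : Fin n, (j : ℕ) ≤ (i : ℕ) → x' j = ω.1 j),
            joint (x', ω.2)) /
          (∑ x' ∈ Finset.univ.filter
              (fun x' : Fin n → X0 => ∀ j : Fin n, (j : ℕ) < (i : ℕ) → x' j = ω.1 j),
            joint (x', ω.2))) / μ (ω.1 i)))
    (G : (Fin n → X0) × ZT → Bool)
    (hG : ∀ (x x' : Fin n → X0) (z : ZT),
      (∀ j : Fin n, (j : ℕ) ≤ (i : ℕ) → x j = x' j) → (G (x, z) = G (x', z))) :
    ∑ ω ∈ Finset.univ.filter (fun ω : (Fin n → X0) × ZT => ¬ G ω), joint ω * Λ ω ≤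
      (∑ ω ∈ Finset.univ.filter (fun ω : (Fin n → X0) × ZT => ¬ G ω), joint ω) *
          Real.log (Fintype.card X0) +
        h2 (∑ ω ∈ Finset.univ.filter (fun ω : (Fin n → X0) × ZT => ¬ G ω), joint ω) := by
  classical
  set B := Finset.univ.filter (fun ω : (Fin n → X0) × ZT => ¬ G ω) with hB
  set q := ∑ ω ∈ B, joint ω with hq
  have hj := hjoint.1
  have hq0 : 0 ≤ q := Finset.sum_nonneg fun ω _ => hj ω
  have hq1 : q ≤ 1 := hjoint.2 ▸
    Finset.sum_le_sum_of_subset_of_nonneg (Finset.subset_univ _) fun ω _ _ => hj ω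
  have hS : ∑ ω ∈ B, joint ω / μ (ω.1 i) ≤ Fintype.card X0 := by
    calc ∑ ω ∈ B, joint ω / μ (ω.1 i)
        ≤ ∑ ω, joint ω / μ (ω.1 i) :=
          Finset.sum_le_sum_of_subset_of_nonneg (Finset.subset_univ _)
            fun ω _ _ => div_nonneg (hj ω) (hμ.1 _)
      _ = ∑ x : Fin n → X0, (∏ j, μ (x j)) / μ (x i) := by
          rw [Fintype.sum_prod_type]
          exact Finset.sum_congr rfl fun x _ => by rw [← hmarg x, Finset.sum_div]
      _ ≤ Fintype.card X0 := sum_prod_div_apply_le_card hμ i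
  have key : ∀ ω ∈ B, joint ω * Λ ω ≤
      joint ω * (Real.log (Fintype.card X0) - Real.log q - 1) +
        q / Fintype.card X0 * (joint ω / μ (ω.1 i)) := by
    intro ω hω
    rcases (hj ω).eq_or_lt with h0 | hpos
    · simp [← h0]
    have hqpos : 0 < q := hpos.trans_le (Finset.single_le_sum (fun ω _ => hj ω) hω)
    have hμpos : 0 < μ (ω.1 i) := by
      refine (hμ.1 _).lt_of_ne' fun h => ?_
      have h1 : joint ω ≤ ∑ z : ZT, joint (ω.1, z) :=
        Finset.single_le_sum (f := fun z => joint (ω.1, z)) (fun z _ => hj _) (mem_univ ω.2)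
      rw [hmarg, Finset.prod_eq_zero (mem_univ i) h] at h1
      linarith
    have : Nonempty X0 := ⟨ω.1 i⟩
    have hcard : (0 : ℝ) < Fintype.card X0 := by exact_mod_cast Fintype.card_pos
    have hloss : Λ ω ≤ -Real.log (μ (ω.1 i)) := by
      rw [hΛ ω, ← Real.log_inv, ← one_div]
      set N := ∑ x' ∈ Finset.univ.filter
        (fun x' : Fin n → X0 => ∀ j : Fin n, (j : ℕ) ≤ (i : ℕ) → x' j = ω.1 j),
          joint (x', ω.2) with hN
      have hNpos : 0 < N := hpos.trans_le <|
        Finset.single_le_sum (f := fun x' => joint (x', ω.2)) (fun x' _ => hj _) (by simp)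
      have hle : N ≤ ∑ x' ∈ Finset.univ.filter
          (fun x' : Fin n → X0 => ∀ j : Fin n, (j : ℕ) < (i : ℕ) → x' j = ω.1 j),
            joint (x', ω.2) :=
        Finset.sum_le_sum_of_subset_of_nonneg
          (Finset.monotone_filter_right _ fun x' _ h j hji => h j hji.le) fun x' _ _ => hj _
      have hDpos := hNpos.trans_le hle
      refine Real.log_le_log (by positivity) ?_
      gcongr
      exact (div_le_one hDpos).2 hle
    have hlog := Real.log_le_sub_one_of_pos
      (show 0 < q / Fintype.card X0 / μ (ω.1 i) by positivity)
    rw [Real.log_div (by positivity) hμpos.ne', Real.log_div hqpos.ne' hcard.ne'] at hlog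
    calc joint ω * Λ ω
        ≤ joint ω * ((Real.log (Fintype.card X0) - Real.log q - 1) +
            q / Fintype.card X0 / μ (ω.1 i)) := by
          gcongr
          linarith
      _ = _ := by ring
  have hfrac : q / Fintype.card X0 * ∑ ω ∈ B, joint ω / μ (ω.1 i) ≤ q := by
    refine (mul_le_mul_of_nonneg_left hS (by positivity)).trans ?_
    rw [div_mul_comm]
    exact mul_le_of_le_one_left hq0 (div_self_le_one _)
  have hsum := Finset.sum_le_sum key
  rw [Finset.sum_add_distrib, ← Finset.sum_mul, ← Finset.mul_sum, ← hq] at hsum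
  have hent : 0 ≤ Real.negMulLog (1 - q) :=
    Real.negMulLog_nonneg (by linarith) (by linarith)
  have hh : h2 q = -(q * Real.log q) + Real.negMulLog (1 - q) := by
    rw [h2, Real.negMulLog, neg_mul]
  rw [hh]
  linarith
end
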